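/- Let 1 < p < ∞ and 0 < β < 1, and define g(x,y) = (ln(4/(x+y)))^β for x, y ∈ (0,1]. Then there is a constant c depending only on p and β such that for every x ∈ (0,1], sup_{0 < h ≤ 1} sup_{0 < y ≤ 1} h^{−1/p} |g(x, y+h) − g(x,y)| ≤ c x^{−1/p} (ln(2/x))^{β−1}. Consequently, for any q with (1−β)q > 1, the function ψ(x) = sup_{0<h≤1} sup_{0<y≤1} h^{−1/p} |g(x,y+h) − g(x,y)| for x ∈ (0,1] (and ψ(x) = 0 otherwise) belongs to the Lorentz space L^{p,q}(ℝ). -/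

import Mathlib

open MeasureTheory Set
open scoped ENNReal

noncomputable section

/-- Extended essential sup norm on ℝ. -/
def einf (φ : ℝ → ℝ) : ℝ≥0∞ := eLpNorm φ ⊤ volume

/-- Lipschitz `α` seminorm (extended real valued):
`sup_{h>0} h^{-α} ‖φ(·+h) - φ‖_∞`. -/
def lipSemiE (α : ℝ) (φ : ℝ → ℝ) : ℝ≥0∞ :=
  ⨆ h ∈ Ioi (0:ℝ), ENNReal.ofReal (h ^ (-α)) * einf (fun x => φ (x + h) - φ x)

/-- Real-valued Lipschitz `α` seminorm `‖φ‖*_{Lip α}`. -/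
def lipSemi (α : ℝ) (φ : ℝ → ℝ) : ℝ := (lipSemiE α φ).toReal

/-- `φ ∈ Lip α`: essentially bounded with finite Lipschitz `α` seminorm. -/
def MemLip (α : ℝ) (φ : ℝ → ℝ) : Prop := einf φ < ⊤ ∧ lipSemiE α φ < ⊤

/-- `‖φ‖_{Lip α} = ‖φ‖_∞ + ‖φ‖*_{Lip α}`. -/
def lipNorm (α : ℝ) (φ : ℝ → ℝ) : ℝ := (einf φ + lipSemiE α φ).toReal

/-- The class `S₀`: measurable functions with finite distribution function at every
positive level. -/
def S0 {X : Type*} [MeasureSpace X] (f : X → ℝ) : Prop :=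
  Measurable f ∧ ∀ s : ℝ, 0 < s → volume {x | s < |f x|} < ⊤

/-- The non-increasing rearrangement `f*`. -/
def rearr {X : Type*} [MeasureSpace X] (f : X → ℝ) (t : ℝ) : ℝ :=
  sInf {s : ℝ | 0 ≤ s ∧ volume {x | s < |f x|} ≤ ENNReal.ofReal t}

/-- `f**(t) = (1/t) ∫₀^t f*(u) du`. -/
def doubleStar {X : Type*} [MeasureSpace X] (f : X → ℝ) (t : ℝ) : ℝ :=
  (∫ u in Ioc (0:ℝ) t, rearr f u) / t

/-- Lorentz `L^{p,q}` norm. -/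
def lorentzNorm {X : Type*} [MeasureSpace X] (p q : ℝ) (f : X → ℝ) : ℝ :=
  (∫ t in Ioi (0:ℝ), (t ^ (1/p) * rearr f t) ^ q / t) ^ (1/q)

/-- Membership in the Lorentz space `L^{p,q}`. -/
def MemLorentz {X : Type*} [MeasureSpace X] (p q : ℝ) (f : X → ℝ) : Prop :=
  S0 f ∧ IntegrableOn (fun t => (t ^ (1/p) * rearr f t) ^ q / t) (Ioi (0:ℝ))

/-- The space `U_p(ℝ²)`: a.e. sections in `Lip (1/p)`, with `Lip (1/p)` norms of the
sections in `L^{p,1}(ℝ)`. -/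
def MemUp (p : ℝ) (f : ℝ × ℝ → ℝ) : Prop :=
  Measurable f ∧
  (∀ᵐ y : ℝ ∂volume, MemLip (1/p) (fun x => f (x, y))) ∧
  (∀ᵐ x : ℝ ∂volume, MemLip (1/p) (fun y => f (x, y))) ∧
  MemLorentz p 1 (fun y => lipNorm (1/p) (fun x => f (x, y))) ∧
  MemLorentz p 1 (fun x => lipNorm (1/p) (fun y => f (x, y)))

/-- The Steklov-type average `f_h`. -/
def avg (f : ℝ × ℝ → ℝ) (h : ℝ) (z : ℝ × ℝ) : ℝ :=
  (∫ u in Ioc (0:ℝ) h, ∫ v in Ioc (0:ℝ) h, f (z.1 + u, z.2 + v)) / h ^ 2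

/-- On positive reals, a power difference of exponent at most one is controlled by the linear
difference weighted at the larger point. -/
lemma rpow_sub_rpow_le_rpow_mul_sub {β a b : ℝ} (hβ1 : β < 1) (hb : 0 < b) (hab : b ≤ a) :
    a ^ β - b ^ β ≤ a ^ (β - 1) * (a - b) := by
  have ha : 0 < a := hb.trans_le hab
  have h1 : a ^ (β - 1) ≤ b ^ (β - 1) := Real.rpow_le_rpow_of_nonpos hb hab (by linarith)
  have h2 : a ^ β = a ^ (β - 1) * a := by rw [← Real.rpow_add_one ha.ne']; ring_nf
  have h3 : b ^ β = b ^ (β - 1) * b := by rw [← Real.rpow_add_one hb.ne']; ring_nf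
  rw [h2, h3]
  nlinarith

lemma log_one_add_le_mul_rpow {p t : ℝ} (hp : 1 < p) (ht : 0 < t) :
    Real.log (1 + t) ≤ p * t ^ (1 / p) := by
  have hp0 : 0 < p := by linarith
  have hs : 0 < t ^ (1 / p) := Real.rpow_pos_of_pos ht _
  have h1 : 1 + t ≤ (1 + t ^ (1 / p)) ^ p := by
    have := Real.add_rpow_le_rpow_add (zero_le_one) hs.le hp.le
    rwa [Real.one_rpow, ← Real.rpow_mul ht.le, one_div_mul_cancel hp0.ne', Real.rpow_one] at this
  calc Real.log (1 + t) ≤ Real.log ((1 + t ^ (1 / p)) ^ p) := Real.log_le_log (by linarith) h1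
    _ = p * Real.log (1 + t ^ (1 / p)) := Real.log_rpow (by linarith) _
    _ ≤ p * t ^ (1 / p) := by
      have := Real.log_le_sub_one_of_pos (show 0 < 1 + t ^ (1 / p) by linarith)
      gcongr
      linarith

/-- Up to a constant, `v ↦ v ^ (-1/p) * log (4/v) ^ (β-1)` is dominated by its values at smaller
points. -/
lemma rpow_mul_log_rpow_le {p β x v : ℝ} (hp : 1 < p) (hβ0 : 0 < β) (hβ1 : β < 1)
    (hx : x ∈ Ioc (0 : ℝ) 1) (hxv : x ≤ v) (hv : v ≤ 2) :
    v ^ (-(1 / p)) * Real.log (4 / v) ^ (β - 1) ≤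
      (1 + p / Real.log 2) * (x ^ (-(1 / p)) * Real.log (2 / x) ^ (β - 1)) := by
  have hp0 : 0 < p := by linarith
  have hx0 : 0 < x := hx.1
  have hv0 : 0 < v := hx0.trans_le hxv
  have hl2 : 0 < Real.log 2 := Real.log_pos (by norm_num)
  set A := Real.log (4 / v) with hA
  set B := Real.log (2 / x) with hB
  set K := 1 + p / Real.log 2 with hK
  set r := (v / x) ^ (1 / p) with hr
  have hA2 : Real.log 2 ≤ A := Real.log_le_log (by norm_num) (by rw [le_div_iff₀ hv0]; linarith)
  have hB2 : Real.log 2 ≤ B :=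
    Real.log_le_log (by norm_num) (by rw [le_div_iff₀ hx0]; linarith [hx.2])
  have hA0 : 0 < A := hl2.trans_le hA2
  have hB0 : 0 < B := hl2.trans_le hB2
  have hK1 : 1 ≤ K := by have := div_pos hp0 hl2; linarith
  have hr1 : 1 ≤ r := Real.one_le_rpow (by rw [le_div_iff₀ hx0]; linarith) (by positivity)
  have hBA : B ≤ K * r * A := by
    have h1 : B ≤ A + Real.log (v / x) := by
      rw [hA, hB, ← Real.log_mul (by positivity) (by positivity)]
      apply Real.log_le_log (by positivity)
      rw [show 4 / v * (v / x) = 4 / x by field_simp]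
      gcongr
      norm_num
    have h2 : Real.log (v / x) ≤ p * r := by
      have := Real.log_le_rpow_div (show 0 ≤ v / x by positivity) (show 0 < 1 / p by positivity)
      rw [← hr] at this
      calc _ ≤ _ := this
        _ = p * r := by field_simp
    have h3 : p * r ≤ p / Real.log 2 * r * A := by
      rw [div_mul_eq_mul_div, div_mul_eq_mul_div, le_div_iff₀ hl2]
      gcongr
    rw [hK]
    nlinarith
  have hratio : B ^ (1 - β) ≤ K * r * A ^ (1 - β) := by
    have hKr : 1 ≤ K * r := by nlinarith
    calc B ^ (1 - β) ≤ (K * r * A) ^ (1 - β) := Real.rpow_le_rpow hB0.le hBA (by linarith)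
      _ = (K * r) ^ (1 - β) * A ^ (1 - β) := Real.mul_rpow (by linarith) hA0.le
      _ ≤ K * r * A ^ (1 - β) := by
        gcongr
        exact Real.rpow_le_self_of_one_le hKr (by linarith)
  have eA : A ^ (β - 1) = (A ^ (1 - β))⁻¹ := by rw [← Real.rpow_neg hA0.le]; ring_nf
  have eB : B ^ (β - 1) = (B ^ (1 - β))⁻¹ := by rw [← Real.rpow_neg hB0.le]; ring_nf
  have er : r = v ^ (1 / p) / x ^ (1 / p) := Real.div_rpow hv0.le hx0.le _
  have hvp : 0 < v ^ (1 / p) := Real.rpow_pos_of_pos hv0 _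
  have hxp : 0 < x ^ (1 / p) := Real.rpow_pos_of_pos hx0 _
  have hAp : 0 < A ^ (1 - β) := Real.rpow_pos_of_pos hA0 _
  have hBp : 0 < B ^ (1 - β) := Real.rpow_pos_of_pos hB0 _
  rw [eA, eB, Real.rpow_neg hv0.le, Real.rpow_neg hx0.le, ← mul_inv, ← mul_inv,
    ← div_eq_mul_inv, inv_eq_one_div, div_le_div_iff₀ (by positivity) (by positivity)]
  rw [er] at hratio
  calc 1 * (x ^ (1 / p) * B ^ (1 - β))
      ≤ x ^ (1 / p) * (K * (v ^ (1 / p) / x ^ (1 / p)) * A ^ (1 - β)) := by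
        rw [one_mul]; gcongr
    _ = K * (v ^ (1 / p) * A ^ (1 - β)) := by field_simp

lemma rpow_neg_mul_abs_log_rpow_sub_le {p β x v h : ℝ} (hp : 1 < p) (hβ0 : 0 < β) (hβ1 : β < 1)
    (hx : x ∈ Ioc (0 : ℝ) 1) (hxv : x ≤ v) (hv : v ≤ 2) (hh : h ∈ Ioc (0 : ℝ) 1) :
    h ^ (-(1 / p)) * |Real.log (4 / (v + h)) ^ β - Real.log (4 / v) ^ β| ≤
      p * (1 + p / Real.log 2) * x ^ (-(1 / p)) * Real.log (2 / x) ^ (β - 1) := by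
  have hp0 : 0 < p := by linarith
  have hv0 : 0 < v := hx.1.trans_le hxv
  have hh0 : 0 < h := hh.1
  have hb : 0 < Real.log (4 / (v + h)) :=
    Real.log_pos (by rw [lt_div_iff₀ (by positivity)]; linarith [hh.2])
  have hba : Real.log (4 / (v + h)) ≤ Real.log (4 / v) :=
    Real.log_le_log (by positivity) (by gcongr; linarith)
  have hsub : Real.log (4 / v) - Real.log (4 / (v + h)) ≤ p * (h / v) ^ (1 / p) := by
    rw [← Real.log_div (by positivity) (by positivity),
      show 4 / v / (4 / (v + h)) = 1 + h / v by field_simp]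
    exact log_one_add_le_mul_rpow hp (by positivity)
  have hmono : Real.log (4 / (v + h)) ^ β ≤ Real.log (4 / v) ^ β :=
    Real.rpow_le_rpow hb.le hba hβ0.le
  rw [abs_sub_comm, abs_of_nonneg (by linarith)]
  have hhp : 0 < h ^ (1 / p) := Real.rpow_pos_of_pos hh0 _
  have hvp : 0 < v ^ (1 / p) := Real.rpow_pos_of_pos hv0 _
  have hL : 0 ≤ Real.log (4 / v) ^ (β - 1) := Real.rpow_nonneg (hb.le.trans hba) _
  calc h ^ (-(1 / p)) * (Real.log (4 / v) ^ β - Real.log (4 / (v + h)) ^ β)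
      ≤ h ^ (-(1 / p)) * (Real.log (4 / v) ^ (β - 1) * (p * (h / v) ^ (1 / p))) := by
        gcongr
        exact (rpow_sub_rpow_le_rpow_mul_sub hβ1 hb hba).trans (by gcongr)
    _ = p * (v ^ (-(1 / p)) * Real.log (4 / v) ^ (β - 1)) := by
        rw [Real.div_rpow hh0.le hv0.le, Real.rpow_neg hh0.le, Real.rpow_neg hv0.le]
        field_simp
    _ ≤ p * ((1 + p / Real.log 2) * (x ^ (-(1 / p)) * Real.log (2 / x) ^ (β - 1))) := by
        exact mul_le_mul_of_nonneg_left (rpow_mul_log_rpow_le hp hβ0 hβ1 hx hxv hv) hp0.le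
    _ = _ := by ring

lemma rearr_nonneg {X : Type*} [MeasureSpace X] (f : X → ℝ) (t : ℝ) : 0 ≤ rearr f t :=
  Real.sInf_nonneg fun _ hs => hs.1

lemma rearr_le {X : Type*} [MeasureSpace X] {f : X → ℝ} {s t : ℝ} (hs : 0 ≤ s)
    (h : volume {x | s < |f x|} ≤ ENNReal.ofReal t) : rearr f t ≤ s :=
  csInf_le ⟨0, fun _ hs => hs.1⟩ ⟨hs, h⟩

lemma antitoneOn_rearr {X : Type*} [MeasureSpace X] {f : X → ℝ} {S : Set ℝ}
    (h : ∀ t ∈ S, ∃ s, 0 ≤ s ∧ volume {x | s < |f x|} ≤ ENNReal.ofReal t) :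
    AntitoneOn (rearr f) S := fun a ha _ _ hab =>
  csInf_le_csInf ⟨0, fun _ hs => hs.1⟩ (h a ha)
    fun _ hs => ⟨hs.1, hs.2.trans (ENNReal.ofReal_le_ofReal hab)⟩

lemma integrableOn_log_two_div_rpow_neg_div {γ : ℝ} (hγ : 1 < γ) :
    IntegrableOn (fun t : ℝ => Real.log (2 / t) ^ (-γ) / t) (Ioc 0 1) := by
  have hpos : ∀ t ∈ Ioc (0 : ℝ) 1, 0 < Real.log (2 / t) := fun t ht =>
    Real.log_pos (by rw [lt_div_iff₀ ht.1]; linarith [ht.2])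
  refine intervalIntegral.integrableOn_deriv_of_nonneg
    (g := fun t : ℝ => Real.log (2 / t) ^ (1 - γ) / (γ - 1)) ?_ ?_ ?_
  · intro t ht
    rcases ht.1.eq_or_lt with rfl | h0
    · have hlim : Filter.Tendsto (fun t : ℝ => Real.log (2 / t) ^ (1 - γ) / (γ - 1))
          (nhdsWithin 0 (Ioi 0)) (nhds (0 / (γ - 1))) := by
        have h1 : Filter.Tendsto (fun t : ℝ => Real.log (2 / t)) (nhdsWithin 0 (Ioi 0))
            Filter.atTop := by
          simp only [div_eq_mul_inv]
          exact Real.tendsto_log_atTop.comp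
            (tendsto_inv_nhdsGT_zero.const_mul_atTop (by norm_num : (0 : ℝ) < 2))
        have h2 := (tendsto_rpow_neg_atTop (show 0 < γ - 1 by linarith)).comp h1
        rw [neg_sub] at h2
        exact h2.div_const _
      have hcont : ContinuousWithinAt (fun t : ℝ => Real.log (2 / t) ^ (1 - γ) / (γ - 1))
          (Ioi 0) 0 := by
        have e : Real.log (2 / (0 : ℝ)) ^ (1 - γ) / (γ - 1) = 0 / (γ - 1) := by
          rw [div_zero, Real.log_zero, Real.zero_rpow (by linarith)]
        rwa [← e] at hlim
      refine (continuousWithinAt_insert_self.mpr hcont).mono fun t ht => ?_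
      rcases ht.1.eq_or_lt with h | h
      · exact Or.inl h.symm
      · exact Or.inr h
    · have := hpos t ⟨h0, ht.2⟩
      refine ContinuousAt.continuousWithinAt (ContinuousAt.div_const ?_ _)
      exact ((continuousAt_const.div continuousAt_id h0.ne').log
        (div_pos two_pos h0).ne').rpow_const (Or.inl this.ne')
  · intro t ht
    have ht0 : 0 < t := ht.1
    have hl := hpos t ⟨ht.1, ht.2.le⟩
    have hd : HasDerivAt (fun t : ℝ => 2 / t) (-2 / t ^ 2) t := by
      simpa using (hasDerivAt_const t (2 : ℝ)).fun_div (hasDerivAt_id' t) ht0.ne'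
    refine (((hd.log (by positivity)).rpow_const (p := 1 - γ) (Or.inl hl.ne')).div_const
      (γ - 1)).congr_deriv ?_
    rw [show 1 - γ - 1 = -γ by ring]
    have : γ - 1 ≠ 0 := by linarith
    field_simp
    ring
  · intro t ht
    have ht0 : 0 < t := ht.1
    have hl := hpos t ⟨ht.1, ht.2.le⟩
    positivity

lemma measurable_ite_iSup_iSup {ι κ : Type*} [Nonempty ι] [Nonempty κ] {S : Set ℝ}
    [DecidablePred (· ∈ S)]
    (hS : MeasurableSet S) {F : ι → κ → ℝ → ℝ} (hF : ∀ i j, ContinuousOn (F i j) S)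
    (hbdd : ∀ x ∈ S, ∃ C, ∀ i j, F i j x ≤ C) :
    Measurable fun x => if x ∈ S then ⨆ i, ⨆ j, F i j x else 0 := by
  have key : LowerSemicontinuous fun x : S => ⨆ i, ⨆ j, F i j x := by
    refine lowerSemicontinuous_ciSup (fun x => ?_) fun i => lowerSemicontinuous_ciSup
      (fun x => ?_) fun j => (continuousOn_iff_continuous_domRestrict.mp (hF i j)).lowerSemicontinuous
    · obtain ⟨C, hC⟩ := hbdd x x.2
      exact ⟨C, by rintro _ ⟨i, rfl⟩; exact ciSup_le (hC i)⟩
    · obtain ⟨C, hC⟩ := hbdd x x.2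
      exact ⟨C, by rintro _ ⟨j, rfl⟩; exact hC i j⟩
  have := Measurable.dite (s := S) key.measurable (measurable_const (a := (0 : ℝ))) hS
  simpa only [dite_eq_ite] using this

/-- A function vanishing off `(0, 1]` which is bounded on each `[t, 1]` by
`c * t ^ (-1/p) * log (2/t) ^ (β-1)` lies in `L^{p,q}` as soon as `(1 - β) q > 1`. -/
lemma memLorentz_of_le_rpow_mul_log_rpow {p q β c : ℝ} {ψ : ℝ → ℝ} (hc : 0 ≤ c) (hq : 1 ≤ q)
    (hβq : 1 < (1 - β) * q) (hψ : Measurable ψ) (hψ0 : ∀ x, x ∉ Ioc (0 : ℝ) 1 → ψ x = 0)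
    (hbound : ∀ t ∈ Ioc (0 : ℝ) 1, ∀ x ∈ Icc t 1,
      |ψ x| ≤ c * t ^ (-(1 / p)) * Real.log (2 / t) ^ (β - 1)) :
    MemLorentz p q ψ := by
  have hsub : ∀ s : ℝ, 0 ≤ s → {x | s < |ψ x|} ⊆ Ioc 0 1 := by
    intro s hs x hx
    by_contra h
    rw [mem_ofPred_eq, hψ0 x h, abs_zero] at hx
    linarith
  have hlog : ∀ t ∈ Ioc (0 : ℝ) 1, 0 < Real.log (2 / t) := fun t ht =>
    Real.log_pos (by rw [lt_div_iff₀ ht.1]; linarith [ht.2])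
  have hb0 : ∀ t ∈ Ioc (0 : ℝ) 1, 0 ≤ c * t ^ (-(1 / p)) * Real.log (2 / t) ^ (β - 1) :=
    fun t ht => mul_nonneg (mul_nonneg hc (Real.rpow_nonneg ht.1.le _))
      (Real.rpow_nonneg (hlog t ht).le _)
  have hsmall : ∀ t ∈ Ioc (0 : ℝ) 1,
      volume {x | c * t ^ (-(1 / p)) * Real.log (2 / t) ^ (β - 1) < |ψ x|} ≤
        ENNReal.ofReal t := by
    intro t ht
    calc _ ≤ volume (Ioc 0 t) := by
          refine measure_mono fun x hx => ?_
          have hx1 := hsub _ (hb0 t ht) hx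
          refine ⟨hx1.1, ?_⟩
          by_contra! h
          exact absurd (hbound t ht x ⟨h.le, hx1.2⟩) (not_le.mpr hx)
      _ = ENNReal.ofReal t := by rw [Real.volume_Ioc, sub_zero]
  have hlarge : ∀ t : ℝ, 1 ≤ t → volume {x | 0 < |ψ x|} ≤ ENNReal.ofReal t := by
    intro t ht
    calc _ ≤ volume (Ioc (0 : ℝ) 1) := measure_mono (hsub 0 le_rfl)
      _ ≤ ENNReal.ofReal t := by
        rw [Real.volume_Ioc, sub_zero]; exact ENNReal.ofReal_le_ofReal ht
  have hanti : AntitoneOn (rearr ψ) (Ioi 0) := by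
    refine antitoneOn_rearr fun t ht => ?_
    rcases le_total t 1 with h | h
    · exact ⟨_, hb0 t ⟨ht, h⟩, hsmall t ⟨ht, h⟩⟩
    · exact ⟨0, le_rfl, hlarge t h⟩
  have hmeas : AEStronglyMeasurable (fun t => (t ^ (1 / p) * rearr ψ t) ^ q / t)
      (volume.restrict (Ioi (0 : ℝ))) := by
    have h1 := aemeasurable_restrict_of_antitoneOn (μ := volume) measurableSet_Ioi hanti
    have h2 : AEMeasurable (fun t : ℝ => t ^ (1 / p)) (volume.restrict (Ioi (0 : ℝ))) := by
      fun_prop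
    exact (((h2.mul h1).pow_const q).div aemeasurable_id).aestronglyMeasurable
  refine ⟨⟨hψ, fun s hs => (measure_mono (hsub s hs.le)).trans_lt (by simp)⟩, ?_⟩
  rw [← Ioc_union_Ioi_eq_Ioi (zero_le_one' ℝ)]
  refine IntegrableOn.union ?_ ?_
  · refine ((integrableOn_log_two_div_rpow_neg_div hβq).const_mul (c ^ q)).mono'
      (hmeas.mono_measure (Measure.restrict_mono Ioc_subset_Ioi_self le_rfl)) ?_
    refine (ae_restrict_iff' measurableSet_Ioc).mpr (.of_forall fun t ht => ?_)
    have ht0 : 0 < t := ht.1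
    have hl := hlog t ht
    have hr0 := rearr_nonneg ψ t
    have hr : t ^ (1 / p) * rearr ψ t ≤ c * Real.log (2 / t) ^ (β - 1) := by
      have htp : 0 < t ^ (1 / p) := Real.rpow_pos_of_pos ht0 _
      calc _ ≤ t ^ (1 / p) * (c * t ^ (-(1 / p)) * Real.log (2 / t) ^ (β - 1)) := by
            gcongr
            exact rearr_le (hb0 t ht) (hsmall t ht)
        _ = _ := by rw [Real.rpow_neg ht0.le]; field_simp
    rw [Real.norm_of_nonneg (by positivity)]
    calc (t ^ (1 / p) * rearr ψ t) ^ q / t ≤ (c * Real.log (2 / t) ^ (β - 1)) ^ q / t := by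
          gcongr
      _ = c ^ q * (Real.log (2 / t) ^ (-((1 - β) * q)) / t) := by
          rw [Real.mul_rpow hc (by positivity), ← Real.rpow_mul hl.le, mul_div_assoc,
            show (β - 1) * q = -((1 - β) * q) by ring]
  · refine integrableOn_zero.congr_fun (fun t ht => ?_) measurableSet_Ioi
    have h0 : rearr ψ t = 0 :=
      (rearr_le le_rfl (hlarge t (le_of_lt ht))).antisymm (rearr_nonneg ψ t)
    simp [h0, Real.zero_rpow (show q ≠ 0 by linarith)]

/-- For `1 < p < ∞`, `0 < β < 1` and
`g(x,y) = (ln(4/(x+y)))^β` on `(0,1]²`, there is `c = c(p,β)` with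
`h^{-1/p} |g(x,y+h) - g(x,y)| ≤ c x^{-1/p} (ln(2/x))^{β-1}` for all
`x, h, y ∈ (0,1]`; consequently, whenever `(1-β) q > 1`, the function
`ψ(x) = sup_{0<h≤1} sup_{0<y≤1} h^{-1/p} |g(x,y+h) - g(x,y)|` (extended by `0`
outside `(0,1]`) belongs to `L^{p,q}(ℝ)`. -/
theorem stmt13 (p β : ℝ) (hp : 1 < p) (hβ0 : 0 < β) (hβ1 : β < 1) :
    ∃ c : ℝ, 0 < c ∧
      (∀ x ∈ Ioc (0:ℝ) 1, ∀ h ∈ Ioc (0:ℝ) 1, ∀ y ∈ Ioc (0:ℝ) 1,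
        h ^ (-(1/p)) *
            |Real.log (4 / (x + (y + h))) ^ β - Real.log (4 / (x + y)) ^ β| ≤
          c * x ^ (-(1/p)) * Real.log (2 / x) ^ (β - 1)) ∧
      (∀ q : ℝ, 1 ≤ q → 1 < (1 - β) * q →
        MemLorentz p q (fun x : ℝ =>
          if x ∈ Ioc (0:ℝ) 1 then
            ⨆ h : Ioc (0:ℝ) 1, ⨆ y : Ioc (0:ℝ) 1,
              (h:ℝ) ^ (-(1/p)) *
                |Real.log (4 / (x + ((y:ℝ) + (h:ℝ)))) ^ β -
                  Real.log (4 / (x + (y:ℝ))) ^ β|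
          else 0)) := by
  have hp0 : 0 < p := by linarith
  have hl2 : 0 < Real.log 2 := Real.log_pos (by norm_num)
  have hc : 0 < p * (1 + p / Real.log 2) := by positivity
  have hbound : ∀ t ∈ Ioc (0 : ℝ) 1, ∀ x ∈ Icc t 1, ∀ h ∈ Ioc (0 : ℝ) 1, ∀ y ∈ Ioc (0 : ℝ) 1,
      h ^ (-(1/p)) *
          |Real.log (4 / (x + (y + h))) ^ β - Real.log (4 / (x + y)) ^ β| ≤
        p * (1 + p / Real.log 2) * t ^ (-(1/p)) * Real.log (2 / t) ^ (β - 1) := by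
    intro t ht x hx h hh y hy
    rw [← add_assoc]
    exact rpow_neg_mul_abs_log_rpow_sub_le hp hβ0 hβ1 ht (by linarith [hx.1, hy.1])
      (by linarith [hx.2, hy.2]) hh
  refine ⟨_, hc, fun x hx => hbound x hx x ⟨le_rfl, hx.2⟩, fun q hq hβq => ?_⟩
  have hne : Nonempty (Ioc (0 : ℝ) 1) := ⟨⟨1, by norm_num⟩⟩
  refine memLorentz_of_le_rpow_mul_log_rpow hc.le hq hβq ?_ (fun x hx => if_neg hx) ?_
  · refine measurable_ite_iSup_iSup (F := fun h y : Ioc (0 : ℝ) 1 => fun x : ℝ =>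
      (h:ℝ) ^ (-(1/p)) * |Real.log (4 / (x + ((y:ℝ) + (h:ℝ)))) ^ β -
        Real.log (4 / (x + (y:ℝ))) ^ β|) measurableSet_Ioc (fun h y => ?_)
      fun x hx => ⟨_, fun h y => hbound x hx x ⟨le_rfl, hx.2⟩ h h.2 y y.2⟩
    have hlog : ∀ a : ℝ, 0 < a →
        ContinuousOn (fun x : ℝ => Real.log (4 / (x + a)) ^ β) (Ioc 0 1) := by
      intro a ha
      have hpos : ∀ x ∈ Ioc (0 : ℝ) 1, 0 < x + a := fun x hx => add_pos hx.1 ha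
      refine ContinuousOn.rpow_const (ContinuousOn.log (ContinuousOn.div continuousOn_const
        (by fun_prop) fun x hx => (hpos x hx).ne') fun x hx => ?_) fun _ _ => Or.inr hβ0.le
      exact (div_pos (by norm_num) (hpos x hx)).ne'
    exact continuousOn_const.mul
      ((hlog _ (add_pos y.2.1 h.2.1)).sub (hlog _ y.2.1)).abs
  · intro t ht x hx
    have hx' : x ∈ Ioc (0 : ℝ) 1 := ⟨ht.1.trans_le hx.1, hx.2⟩
    rw [if_pos hx', abs_of_nonneg]
    · exact ciSup_le fun h => ciSup_le fun y => hbound t ht x hx h h.2 y y.2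
    · exact Real.iSup_nonneg fun h => Real.iSup_nonneg fun y =>
        mul_nonneg (Real.rpow_nonneg h.2.1.le _) (abs_nonneg _)

end
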